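/- arXiv:2003.12707 — 2 statements merged into one kernel-verified Lean document; each statement's English description precedes it below -/
import Mathlib

section
/- Let R(q) = (q,q^4;q^5)_∞/(q^2,q^3;q^5)_∞ and E(q)=(q;q)_∞. Then R(q) R(q^2)/R(q^4)^2 - q^2 R(q^4)^2/(R(q) R(q^2)) = E(q) E(q^5)^3/E(q^{10})^4. -/
/-- Euler's product E(q) = ∏_{k≥0} (1 - q^{k+1}). -/
noncomputable def E (q : ℂ) : ℂ := ∏' k : ℕ, (1 - q ^ (k + 1))

/-- q-Pochhammer infinite product (a;q)_∞ = ∏_{k≥0} (1 - a q^k). -/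
noncomputable def qp (a q : ℂ) : ℂ := ∏' k : ℕ, (1 - a * q ^ k)

/-- Rogers–Ramanujan function G(q) = 1/((q,q^4;q^5)_∞). -/
noncomputable def G (q : ℂ) : ℂ := 1 / (qp q (q ^ 5) * qp (q ^ 4) (q ^ 5))

/-- Rogers–Ramanujan function H(q) = 1/((q^2,q^3;q^5)_∞). -/
noncomputable def H (q : ℂ) : ℂ := 1 / (qp (q ^ 2) (q ^ 5) * qp (q ^ 3) (q ^ 5))

/-- Rogers–Ramanujan continued fraction product R(q). -/
noncomputable def R (q : ℂ) : ℂ :=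
  (qp q (q ^ 5) * qp (q ^ 4) (q ^ 5)) / (qp (q ^ 2) (q ^ 5) * qp (q ^ 3) (q ^ 5))

open Filter Topology

theorem norm_pow_lt_one {p : ℂ} (hp : ‖p‖ < 1) {m : ℕ} (hm : m ≠ 0) : ‖p ^ m‖ < 1 := by
  rw [norm_pow]
  exact pow_lt_one₀ (norm_nonneg _) hp hm

theorem pow_ne_one_of_norm_lt_one {p : ℂ} (hp : ‖p‖ < 1) {m : ℕ} (hm : m ≠ 0) : p ^ m ≠ 1 := by
  intro h
  have := norm_pow_lt_one hp hm
  simp [h] at this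

theorem summable_norm_neg_mul_pow (a : ℂ) {p : ℂ} (hp : ‖p‖ < 1) :
    Summable fun k : ℕ => ‖-(a * p ^ k)‖ := by
  simp only [norm_neg, norm_mul, norm_pow]
  exact (summable_geometric_of_lt_one (norm_nonneg _) hp).mul_left _

theorem multipliable_qp (a : ℂ) {p : ℂ} (hp : ‖p‖ < 1) :
    Multipliable fun k : ℕ => 1 - a * p ^ k := by
  simpa only [sub_eq_add_neg] using
    multipliable_one_add_of_summable (summable_norm_neg_mul_pow a hp)

theorem tendsto_qp (a : ℂ) {p : ℂ} (hp : ‖p‖ < 1) :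
    Tendsto (fun N => ∏ k ∈ Finset.range N, (1 - a * p ^ k)) atTop (𝓝 (qp a p)) :=
  (multipliable_qp a hp).hasProd.tendsto_prod_nat

theorem qp_ne_zero {a p : ℂ} (ha : ‖a‖ < 1) (hp : ‖p‖ < 1) : qp a p ≠ 0 := by
  have h := tprod_one_add_ne_zero_of_summable (f := fun k : ℕ => -(a * p ^ k)) ?_
    (summable_norm_neg_mul_pow a hp)
  · simpa only [qp, sub_eq_add_neg] using h
  · intro k hk
    have h1 : a * p ^ k = 1 := by linear_combination -hk
    have h2 : ‖a * p ^ k‖ < 1 := by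
      rw [norm_mul, norm_pow]
      exact mul_lt_one_of_nonneg_of_lt_one_left (norm_nonneg _) ha
        (pow_le_one₀ (norm_nonneg _) hp.le)
    simp [h1] at h2

theorem qp_pow_ne_zero {q : ℂ} (hq : ‖q‖ < 1) {i m : ℕ} (hi : i ≠ 0) (hm : m ≠ 0) :
    qp (q ^ i) (q ^ m) ≠ 0 :=
  qp_ne_zero (norm_pow_lt_one hq hi) (norm_pow_lt_one hq hm)

theorem qp_eq_prod_qp (a : ℂ) {p : ℂ} (hp : ‖p‖ < 1) {m : ℕ} (hm : m ≠ 0) :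
    qp a p = ∏ j ∈ Finset.range m, qp (a * p ^ j) (p ^ m) := by
  have h1 : Tendsto (fun N => ∏ k ∈ Finset.range (m * N), (1 - a * p ^ k)) atTop (𝓝 (qp a p)) :=
    (tendsto_qp a hp).comp (tendsto_id.const_mul_atTop' (Nat.pos_of_ne_zero hm))
  have h2 := tendsto_finsetProd (Finset.range m)
    fun j _ => tendsto_qp (a * p ^ j) (norm_pow_lt_one hp hm)
  refine tendsto_nhds_unique h1 (h2.congr fun N => ?_)
  induction N with
  | zero => simp
  | succ N ih =>
    rw [Nat.mul_succ, Finset.prod_range_add, ← ih]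
    simp only [Finset.prod_range_succ _ N, Finset.prod_mul_distrib]
    congr 1
    refine Finset.prod_congr rfl fun j _ => ?_
    rw [← pow_mul, mul_assoc, ← pow_add, add_comm j]

theorem qp_neg_mul_qp (a : ℂ) {p : ℂ} (hp : ‖p‖ < 1) :
    qp (-a) p * qp a p = qp (a ^ 2) (p ^ 2) := by
  unfold qp
  rw [← (multipliable_qp (-a) hp).tprod_mul (multipliable_qp a hp)]
  refine tprod_congr fun k => ?_
  ring

/-- The `n`-th term of the bilateral theta series with argument `z` and nome `p`. -/
noncomputable def thetaTerm (z p : ℂ) (n : ℤ) : ℂ := (-z) ^ n * p ^ (n * (n - 1) / 2)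

/-- The theta series `∑ (-1)^n z^n p^(n(n-1)/2)` over all integers `n`. -/
noncomputable def theta (z p : ℂ) : ℂ := ∑' n : ℤ, thetaTerm z p n

theorem thetaTerm_add_one {z p : ℂ} (hz : z ≠ 0) (hp : p ≠ 0) (n : ℤ) :
    thetaTerm z p (n + 1) = -z * p ^ n * thetaTerm z p n := by
  have h : (n + 1) * (n + 1 - 1) / 2 = n * (n - 1) / 2 + n := by
    rw [show (n + 1) * (n + 1 - 1) = n * (n - 1) + n * 2 by ring, Int.add_mul_ediv_right _ _ two_ne_zero]
  rw [thetaTerm, thetaTerm, h, zpow_add₀ hp, zpow_add_one₀ (neg_ne_zero.2 hz)]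
  ring

theorem thetaTerm_ne_zero {z p : ℂ} (hz : z ≠ 0) (hp : p ≠ 0) (n : ℤ) : thetaTerm z p n ≠ 0 :=
  mul_ne_zero (zpow_ne_zero _ (neg_ne_zero.2 hz)) (zpow_ne_zero _ hp)

theorem summable_norm_thetaTerm {z p : ℂ} (hz : z ≠ 0) (hp : p ≠ 0) (hp1 : ‖p‖ < 1) :
    Summable fun n => ‖thetaTerm z p n‖ := by
  have hne (n : ℤ) : ‖thetaTerm z p n‖ ≠ 0 := norm_ne_zero_iff.2 (thetaTerm_ne_zero hz hp n)
  have hpow := tendsto_pow_atTop_nhds_zero_of_lt_one (norm_nonneg p) hp1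
  refine Summable.of_nat_of_neg ?_ ?_ <;>
    refine summable_of_ratio_test_tendsto_lt_one zero_lt_one (.of_forall fun n => hne _) ?_ <;>
    simp only [norm_norm]
  · have h := hpow.const_mul ‖z‖
    rw [mul_zero] at h
    refine h.congr fun n => ?_
    rw [eq_div_iff (hne _), Nat.cast_succ, thetaTerm_add_one hz hp]
    simp
  · have h := hpow.const_mul (‖p‖ / ‖z‖)
    rw [mul_zero] at h
    refine h.congr fun n => ?_
    rw [eq_div_iff (hne _), show (-(n : ℤ)) = -((n + 1 : ℕ) : ℤ) + 1 by push_cast; ring,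
      thetaTerm_add_one hz hp]
    have hz' : ‖z‖ ≠ 0 := norm_ne_zero_iff.2 hz
    have hp' : ‖p‖ ≠ 0 := norm_ne_zero_iff.2 hp
    simp only [norm_mul, norm_neg, norm_inv, norm_pow, zpow_neg, zpow_natCast, pow_succ]
    field_simp

/-- The reciprocal of `(p;p)_m`, extended by zero to negative `m`. -/
noncomputable def invPoch (p : ℂ) (m : ℤ) : ℂ :=
  if m < 0 then 0 else (∏ k ∈ Finset.range m.toNat, (1 - p * p ^ k))⁻¹

theorem invPoch_sub_one {p : ℂ} (hp1 : ‖p‖ < 1) (m : ℤ) :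
    invPoch p (m - 1) = (1 - p ^ m) * invPoch p m := by
  unfold invPoch
  rcases lt_trichotomy m 0 with h | h | h
  · rw [if_pos (by lia), if_pos h, mul_zero]
  · simp [h]
  · obtain ⟨n, rfl⟩ : ∃ n : ℕ, m = n + 1 := ⟨(m - 1).toNat, by lia⟩
    have h1 : (1 : ℂ) - p * p ^ n ≠ 0 := by
      rw [← pow_succ']
      exact sub_ne_zero.2 (pow_ne_one_of_norm_lt_one hp1 n.succ_ne_zero).symm
    have h2 : p ^ ((n : ℤ) + 1) = p * p ^ n := by
      rw [← pow_succ']; exact_mod_cast rfl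
    rw [if_neg (by lia), if_neg (by lia), h2, add_sub_cancel_right, Int.toNat_natCast,
      show ((n : ℤ) + 1).toNat = n + 1 by lia, Finset.prod_range_succ, mul_inv, mul_comm,
      mul_assoc, inv_mul_cancel₀ h1, mul_one]

theorem hasSum_finite_triple_product {z p : ℂ} (hz : z ≠ 0) (hp : p ≠ 0) (hp1 : ‖p‖ < 1) (N : ℕ) :
    HasSum (fun n : ℤ => (∏ k ∈ Finset.range (2 * N), (1 - p * p ^ k)) *
        (invPoch p (N + n) * invPoch p (N - n)) * thetaTerm z p n)
      (∏ k ∈ Finset.range N, ((1 - z * p ^ k) * (1 - p / z * p ^ k))) := by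
  induction N with
  | zero =>
    convert hasSum_single (0 : ℤ) ?_ using 1
    · simp [invPoch, thetaTerm]
    · intro n hn
      rcases lt_or_gt_of_ne hn with h | h <;> simp [invPoch, h]
  | succ N ih =>
    have hl := (Equiv.subRight (1 : ℤ)).hasSum_iff.2 ih
    have hr := (Equiv.addRight (1 : ℤ)).hasSum_iff.2 ih
    have h := ((ih.mul_left (1 + p ^ (2 * N + 1))).sub (hl.mul_left (z * p ^ N))).sub
      (hr.mul_left (p / z * p ^ N))
    rw [Finset.prod_range_succ, show ∀ S : ℂ, S * ((1 - z * p ^ N) * (1 - p / z * p ^ N)) =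
      (1 + p ^ (2 * N + 1)) * S - z * p ^ N * S - p / z * p ^ N * S by intro S; field_simp; ring]
    refine Eq.mpr (congrArg (HasSum · _) (funext fun n => ?_)) h
    have e1 : invPoch p (N + n) = (1 - p * p ^ N * p ^ n) * invPoch p (N + 1 + n) := by
      rw [show (N + n : ℤ) = N + 1 + n - 1 by ring, invPoch_sub_one hp1, zpow_add₀ hp,
        zpow_add₀ hp]
      simp [mul_comm]
    have e2 : invPoch p (N - n) = (1 - p * p ^ N / p ^ n) * invPoch p (N + 1 - n) := by
      rw [show (N - n : ℤ) = N + 1 - n - 1 by ring, invPoch_sub_one hp1, zpow_sub₀ hp,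
        zpow_add₀ hp]
      simp [mul_comm]
    have e3 : invPoch p (N + (n - 1)) = (1 - p ^ N * p ^ n) * invPoch p (N + n) := by
      rw [show (N + (n - 1) : ℤ) = N + n - 1 by ring, invPoch_sub_one hp1, zpow_add₀ hp]
      simp
    have e4 : invPoch p (N - (n + 1)) = (1 - p ^ N / p ^ n) * invPoch p (N - n) := by
      rw [show (N - (n + 1) : ℤ) = N - n - 1 by ring, invPoch_sub_one hp1, zpow_sub₀ hp]
      simp
    have t1 : thetaTerm z p (n + 1) = -z * p ^ n * thetaTerm z p n := thetaTerm_add_one hz hp n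
    have t2 : thetaTerm z p (n - 1) = -(p / (z * p ^ n)) * thetaTerm z p n := by
      have := thetaTerm_add_one hz hp (n - 1)
      rw [sub_add_cancel] at this
      rw [this, zpow_sub_one₀ hp]
      have := zpow_ne_zero n hp
      field_simp
    simp only [Function.comp_apply, Equiv.subRight_apply, Equiv.coe_addRight]
    rw [show (N : ℤ) - (n - 1) = N + 1 - n by ring, show (N : ℤ) + (n + 1) = N + 1 + n by ring,
      e3, e4, e1, e2, t1, t2, Nat.mul_succ, Finset.prod_range_succ, Finset.prod_range_succ]
    push_cast
    have := zpow_ne_zero n hp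
    field_simp
    ring

theorem tendsto_invPoch {p : ℂ} (hp1 : ‖p‖ < 1) :
    Tendsto (invPoch p) atTop (𝓝 (qp p p)⁻¹) := by
  have h1 := ((tendsto_qp p hp1).inv₀ (qp_ne_zero hp1 hp1)).comp
    (tendsto_atTop_atTop.2 fun b => ⟨b, fun a ha => by lia⟩ : Tendsto Int.toNat atTop atTop)
  refine h1.congr' ?_
  filter_upwards [eventually_ge_atTop 0] with m hm
  rw [invPoch, if_neg hm.not_gt]
  rfl

theorem exists_norm_invPoch_le {p : ℂ} (hp1 : ‖p‖ < 1) : ∃ C, ∀ m, ‖invPoch p m‖ ≤ C := by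
  have h1 := (tendsto_invPoch hp1).comp tendsto_natCast_atTop_atTop
  obtain ⟨C, hC⟩ := (Metric.isBounded_range_of_tendsto _ h1).exists_norm_le
  refine ⟨C, fun m => ?_⟩
  rcases lt_or_ge m 0 with h | h
  · rw [invPoch, if_pos h, norm_zero]
    exact (norm_nonneg _).trans (hC _ ⟨0, rfl⟩)
  · obtain ⟨n, rfl⟩ := Int.eq_ofNat_of_zero_le h
    exact hC _ ⟨n, rfl⟩

/-- The Jacobi triple product identity. -/
theorem theta_eq_qp {z p : ℂ} (hz : z ≠ 0) (hp : p ≠ 0) (hp1 : ‖p‖ < 1) :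
    theta z p = qp z p * qp (p / z) p * qp p p := by
  have hpp := qp_ne_zero hp1 hp1
  obtain ⟨C, hC⟩ := exists_norm_invPoch_le hp1
  have hpoch : Tendsto (fun N : ℕ => ∏ k ∈ Finset.range (2 * N), (1 - p * p ^ k)) atTop
      (𝓝 (qp p p)) := (tendsto_qp p hp1).comp (tendsto_id.const_mul_atTop' two_pos)
  obtain ⟨D, hD⟩ := (Metric.isBounded_range_of_tendsto _ hpoch).exists_norm_le
  have hlim := tendsto_tsum_of_dominated_convergence (𝓕 := atTop)
    (f := fun (N : ℕ) (n : ℤ) => (∏ k ∈ Finset.range (2 * N), (1 - p * p ^ k)) *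
      (invPoch p (N + n) * invPoch p (N - n)) * thetaTerm z p n)
    (g := fun n => qp p p * ((qp p p)⁻¹ * (qp p p)⁻¹) * thetaTerm z p n)
    (bound := fun n => D * (C * C) * ‖thetaTerm z p n‖)
    ((summable_norm_thetaTerm hz hp hp1).mul_left _) ?_ ?_
  · simp only [(hasSum_finite_triple_product hz hp hp1 _).tsum_eq, Finset.prod_mul_distrib] at hlim
    have h := tendsto_nhds_unique hlim ((tendsto_qp z hp1).mul (tendsto_qp (p / z) hp1))
    rw [tsum_mul_left] at h
    rw [← h, theta]
    field_simp
  · intro n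
    refine (hpoch.mul (Tendsto.mul ?_ ?_)).mul_const _
    · exact (tendsto_invPoch hp1).comp
        (tendsto_atTop_add_const_right _ n tendsto_natCast_atTop_atTop)
    · exact (tendsto_invPoch hp1).comp
        (tendsto_atTop_add_const_right _ (-n) tendsto_natCast_atTop_atTop)
  · refine .of_forall fun N n => ?_
    rw [norm_mul, norm_mul, norm_mul]
    have hC0 : 0 ≤ C := (norm_nonneg _).trans (hC 0)
    gcongr
    · exact (norm_nonneg _).trans (hD _ ⟨0, rfl⟩)
    · exact hD _ ⟨N, rfl⟩
    · exact hC _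
    · exact hC _

theorem tsum_eq_sum_tsum_of_bijective {α β : Type*} {N : ℕ} {f : β → ℂ} (hf : Summable f)
    (g : Fin N → α → β) (hg : Function.Bijective fun x : Fin N × α => g x.1 x.2) :
    ∑' b, f b = ∑ i, ∑' a, f (g i a) := by
  have hs : Summable fun x : Fin N × α => f (g x.1 x.2) := hf.comp_injective hg.injective
  rw [← (Equiv.ofBijective _ hg).tsum_eq f]
  simp only [Equiv.ofBijective_apply]
  rw [hs.tsum_prod, tsum_fintype]

theorem neg_one_zpow_eq_of_sub_even {a b : ℤ} (h : Even (a - b)) : (-1 : ℂ) ^ a = (-1) ^ b := by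
  have h1 := h.neg_one_zpow (α := ℂ)
  rwa [zpow_sub₀ (by norm_num), div_eq_one_iff_eq (zpow_ne_zero _ (by norm_num))] at h1

theorem thetaTerm_pow {w : ℂ} (hw : w ≠ 0) {a b : ℕ} {n e : ℤ}
    (h : 2 * e = 2 * a * n + b * (n * (n - 1))) :
    thetaTerm (w ^ a) (w ^ b) n = (-1) ^ n * w ^ e := by
  obtain ⟨k, hk⟩ := Int.even_mul_pred_self n
  have hk' : n * (n - 1) / 2 = k := by lia
  have he : e = a * n + b * k := by
    rw [hk] at h
    linarith
  rw [thetaTerm, hk', neg_eq_neg_one_mul, mul_zpow, he, zpow_add₀ hw, zpow_mul, zpow_mul]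
  simp [mul_assoc]

theorem thetaTerm_neg_pow {w : ℂ} (hw : w ≠ 0) {a b : ℕ} {n e : ℤ}
    (h : 2 * e = 2 * a * n + b * (n * (n - 1))) :
    thetaTerm (-w ^ a) (w ^ b) n = w ^ e := by
  obtain ⟨k, hk⟩ := Int.even_mul_pred_self n
  have hk' : n * (n - 1) / 2 = k := by lia
  have he : e = a * n + b * k := by
    rw [hk] at h
    linarith
  rw [thetaTerm, hk', neg_neg, he, zpow_add₀ hw, zpow_mul, zpow_mul]
  simp

theorem theta_mul_theta {z p z' p' : ℂ} (hz : z ≠ 0) (hp : p ≠ 0) (hp1 : ‖p‖ < 1)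
    (hz' : z' ≠ 0) (hp' : p' ≠ 0) (hp1' : ‖p'‖ < 1) :
    theta z p * theta z' p' = ∑' x : ℤ × ℤ, thetaTerm z p x.1 * thetaTerm z' p' x.2 :=
  tsum_mul_tsum_of_summable_norm (summable_norm_thetaTerm hz hp hp1)
    (summable_norm_thetaTerm hz' hp' hp1')

theorem summable_thetaTerm_mul {z p z' p' : ℂ} (hz : z ≠ 0) (hp : p ≠ 0) (hp1 : ‖p‖ < 1)
    (hz' : z' ≠ 0) (hp' : p' ≠ 0) (hp1' : ‖p'‖ < 1) :
    Summable fun x : ℤ × ℤ => thetaTerm z p x.1 * thetaTerm z' p' x.2 :=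
  summable_mul_of_summable_norm (summable_norm_thetaTerm hz hp hp1)
    (summable_norm_thetaTerm hz' hp' hp1')

theorem thetaTerm_mul_mul_thetaTerm_div {x y p : ℂ} (hx : x ≠ 0) (hy : y ≠ 0) (hp : p ≠ 0)
    {a b e : ℤ} (h : 2 * e = a * (a - 1) + b * (b - 1)) :
    thetaTerm (x * y) p a * thetaTerm (x / y) p b =
      (-1) ^ (a + b) * (x ^ (a + b) * y ^ (a - b) * p ^ e) := by
  obtain ⟨k, hk⟩ := Int.even_mul_pred_self a
  obtain ⟨l, hl⟩ := Int.even_mul_pred_self b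
  have hk' : a * (a - 1) / 2 = k := by lia
  have hl' : b * (b - 1) / 2 = l := by lia
  have he : e = k + l := by linarith
  have hy' := zpow_ne_zero b hy
  rw [thetaTerm, thetaTerm, hk', hl', neg_eq_neg_one_mul, neg_eq_neg_one_mul (x / y), mul_zpow,
    mul_zpow, mul_zpow, div_zpow, he, zpow_add₀ hp, zpow_add₀ hx, zpow_sub₀ hy,
    zpow_add₀ (by norm_num)]
  field_simp

/-- Splitting of the product of two theta series by the parity of the sum of the indices. -/
theorem theta_mul_mul_theta_div {x y p : ℂ} (hx : x ≠ 0) (hy : y ≠ 0) (hp : p ≠ 0)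
    (hp1 : ‖p‖ < 1) :
    theta (x * y) p * theta (x / y) p =
      theta (-x ^ 2) (p ^ 2) * theta (-(y ^ 2 * p)) (p ^ 2) -
        x * theta (-(x ^ 2 * p)) (p ^ 2) * (theta (-y ^ 2) (p ^ 2) / y) := by
  have hxy : x * y ≠ 0 := mul_ne_zero hx hy
  have hxy' : x / y ≠ 0 := div_ne_zero hx hy
  have hp2 : p ^ 2 ≠ 0 := pow_ne_zero _ hp
  have hp21 : ‖p ^ 2‖ < 1 := norm_pow_lt_one hp1 two_ne_zero
  have hsq (u : ℂ) (n : ℤ) : thetaTerm (-u ^ 2) (p ^ 2) n = (u ^ n) ^ 2 * p ^ (n * (n - 1)) := by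
    obtain ⟨k, hk⟩ := Int.even_mul_pred_self n
    have hk' : n * (n - 1) / 2 = k := by lia
    rw [thetaTerm, hk', hk, neg_neg, ← two_mul, zpow_mul]
    simp only [← zpow_natCast, ← zpow_mul]
    simp [mul_comm]
  have hsqp (u : ℂ) (n : ℤ) :
      thetaTerm (-(u ^ 2 * p)) (p ^ 2) n = (u ^ n) ^ 2 * p ^ (n * n) := by
    obtain ⟨k, hk⟩ := Int.even_mul_pred_self n
    have hk' : n * (n - 1) / 2 = k := by lia
    rw [thetaTerm, hk', neg_neg, mul_zpow, show n * n = n + 2 * k by linarith, zpow_add₀ hp,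
      zpow_mul]
    simp only [← zpow_natCast, ← zpow_mul]
    simp only [Nat.cast_ofNat, mul_comm]
    ring
  rw [theta_mul_theta hxy hp hp1 hxy' hp hp1,
    tsum_eq_sum_tsum_of_bijective (summable_thetaTerm_mul hxy hp hp1 hxy' hp hp1)
      (![fun i => (i.1 + i.2, i.1 - i.2), fun i => (i.1 + i.2, i.1 - i.2 + 1)] :
        Fin 2 → ℤ × ℤ → ℤ × ℤ), Fin.sum_univ_two, sub_eq_add_neg]
  · congr 1
    · rw [theta_mul_theta (neg_ne_zero.2 (pow_ne_zero 2 hx)) hp2 hp21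
        (neg_ne_zero.2 (mul_ne_zero (pow_ne_zero 2 hy) hp)) hp2 hp21]
      refine tsum_congr fun ⟨i, j⟩ => ?_
      rw [hsq, hsqp]
      simp only [Matrix.cons_val_zero]
      rw [thetaTerm_mul_mul_thetaTerm_div hx hy hp (e := i * (i - 1) + j * j) (by ring),
        Even.neg_one_zpow (n := i + j + (i - j)) ⟨i, by ring⟩, zpow_add₀ hp,
        show i + j + (i - j) = i + i by ring, show i + j - (i - j) = j + j by ring,
        zpow_add₀ hx, zpow_add₀ hy]
      ring
    · have h := theta_mul_theta (neg_ne_zero.2 (mul_ne_zero (pow_ne_zero 2 hx) hp)) hp2 hp21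
        (neg_ne_zero.2 (pow_ne_zero 2 hy)) hp2 hp21
      rw [show ∀ a b : ℂ, -(x * a * (b / y)) = -(x / y) * (a * b) by intro a b; ring, h,
        ← tsum_mul_left]
      refine tsum_congr fun ⟨i, j⟩ => ?_
      rw [hsq, hsqp]
      simp only [Matrix.cons_val_one, Matrix.cons_val_fin_one]
      rw [thetaTerm_mul_mul_thetaTerm_div hx hy hp (e := i * i + j * (j - 1)) (by ring),
        Odd.neg_one_zpow (n := i + j + (i - j + 1)) ⟨i, by ring⟩, zpow_add₀ hp,
        show i + j + (i - j + 1) = i + i + 1 by ring,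
        show i + j - (i - j + 1) = j + j - 1 by ring,
        zpow_add_one₀ hx, zpow_add₀ hx, zpow_sub_one₀ hy, zpow_add₀ hy]
      ring
  · constructor
    · rintro ⟨a, i, j⟩ ⟨b, k, l⟩ h
      fin_cases a <;> fin_cases b <;> simp at h ⊢ <;> lia
    · rintro ⟨m, n⟩
      rcases Int.even_or_odd' (m + n) with ⟨k, hk | hk⟩
      · exact ⟨(0, k, m - k), by simp; lia⟩
      · exact ⟨(1, k, m - k), by simp; lia⟩

/-- Weierstrass' three-term relation for theta series. -/
theorem theta_three_term {x y u v p : ℂ} (hx : x ≠ 0) (hy : y ≠ 0) (hu : u ≠ 0) (hv : v ≠ 0)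
    (hp : p ≠ 0) (hp1 : ‖p‖ < 1) :
    y * v * (theta (x * y) p * theta (x / y) p * (theta (u * v) p * theta (u / v) p)) +
      x * v * (theta (u * x) p * theta (u / x) p * (theta (y * v) p * theta (y / v) p)) =
      y * v * (theta (x * v) p * theta (x / v) p * (theta (u * y) p * theta (u / y) p)) := by
  rw [theta_mul_mul_theta_div hx hy hp hp1, theta_mul_mul_theta_div hu hv hp hp1,
    theta_mul_mul_theta_div hu hx hp hp1, theta_mul_mul_theta_div hy hv hp hp1,
    theta_mul_mul_theta_div hx hv hp hp1, theta_mul_mul_theta_div hu hy hp hp1]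
  field_simp
  ring

/-- Watson's identity, which underlies `G(q) G(q⁴) + q H(q) H(q⁴) = φ(q) / E(q²)`. -/
theorem theta_watson {w : ℂ} (hw : w ≠ 0) (hw1 : ‖w‖ < 1) :
    theta (w ^ 3) (w ^ 5) * theta (w ^ 12) (w ^ 20) +
      w * (theta (w ^ 4) (w ^ 5) * theta (w ^ 16) (w ^ 20)) =
      theta (-w ^ 3) (w ^ 4) * theta (w ^ 2) (w ^ 4) := by
  have hne (n : ℕ) : w ^ n ≠ 0 := pow_ne_zero n hw
  have h4 : ‖w ^ 4‖ < 1 := norm_pow_lt_one hw1 four_ne_zero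
  have h5 : ‖w ^ 5‖ < 1 := norm_pow_lt_one hw1 (by norm_num)
  have h20 : ‖w ^ 20‖ < 1 := norm_pow_lt_one hw1 (by norm_num)
  have hbij : Function.Bijective fun x : Fin 2 × ℤ × ℤ =>
      (![fun i => (2 * i.1, i.2), fun i => (2 * i.1 - 1, i.2)] : Fin 2 → ℤ × ℤ → ℤ × ℤ)
        x.1 x.2 := by
    constructor
    · rintro ⟨a, i, j⟩ ⟨b, k, l⟩ h
      fin_cases a <;> fin_cases b <;> simp at h ⊢ <;> lia
    · rintro ⟨m, n⟩
      rcases Int.even_or_odd' m with ⟨k, hk | hk⟩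
      · exact ⟨(0, k, n), by simp; lia⟩
      · exact ⟨(1, k + 1, n), by simp; lia⟩
  have hbij5 : Function.Bijective fun x : Fin 5 × ℤ × ℤ =>
      (![fun i => (i.1 + 2 * i.2, i.2 - 2 * i.1), fun i => (-i.1 - 2 * i.2, 2 * i.1 - 1 - i.2),
        fun i => (-i.1 - 2 * i.2 - 1, 2 * i.1 - i.2),
        fun i => (i.1 + 2 * i.2, i.2 - 2 * i.1 + 1),
        fun i => (i.1, 5 * i.2 + 2 - 2 * i.1)] : Fin 5 → ℤ × ℤ → ℤ × ℤ) x.1 x.2 := by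
    constructor
    · rintro ⟨a, i, j⟩ ⟨b, k, l⟩ h
      fin_cases a <;> fin_cases b <;> simp at h ⊢ <;> lia
    · rintro ⟨m, n⟩
      have h : (n + 2 * m) % 5 = 0 ∨ (n + 2 * m) % 5 = 1 ∨ (n + 2 * m) % 5 = 2 ∨
        (n + 2 * m) % 5 = 3 ∨ (n + 2 * m) % 5 = 4 := by lia
      rcases h with h | h | h | h | h
      · exact ⟨(0, m - 2 * ((n + 2 * m) / 5), (n + 2 * m) / 5), by simp; lia⟩
      · exact ⟨(3, m - 2 * ((n + 2 * m) / 5), (n + 2 * m) / 5), by simp; lia⟩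
      · exact ⟨(4, m, (n + 2 * m) / 5), by simp; lia⟩
      · exact ⟨(2, -m - 1 + 2 * ((n + 2 * m) / 5 + 1), -((n + 2 * m) / 5) - 1), by simp; lia⟩
      · exact ⟨(1, -m + 2 * ((n + 2 * m) / 5 + 1), -((n + 2 * m) / 5) - 1), by simp; lia⟩
  have hself : ∑' i : ℤ × ℤ, thetaTerm (-w ^ 3) (w ^ 4) i.1 *
      thetaTerm (w ^ 2) (w ^ 4) (5 * i.2 + 2 - 2 * i.1) = 0 := by
    let e : ℤ × ℤ ≃ ℤ × ℤ :=
      { toFun := fun i => (i.1 - 4 * i.2 - 2, -i.2 - 1)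
        invFun := fun i => (i.1 - 4 * i.2 - 2, -i.2 - 1)
        left_inv := fun i => by ext <;> simp; ring
        right_inv := fun i => by ext <;> simp; ring }
    rw [← self_eq_neg, ← tsum_neg, ← e.tsum_eq]
    refine tsum_congr fun ⟨i, j⟩ => ?_
    simp only [e, Equiv.coe_fn_mk]
    rw [thetaTerm_neg_pow hw (e := 2 * (i - 4 * j - 2) ^ 2 + (i - 4 * j - 2)) (by push_cast; ring),
      thetaTerm_neg_pow hw (e := 2 * i ^ 2 + i) (by push_cast; ring),
      thetaTerm_pow hw (e := 2 * (5 * (-j - 1) + 2 - 2 * (i - 4 * j - 2)) ^ 2) (by push_cast; ring),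
      thetaTerm_pow hw (e := 2 * (5 * j + 2 - 2 * i) ^ 2) (by push_cast; ring),
      mul_left_comm, mul_left_comm (w ^ _), ← zpow_add₀ hw, ← zpow_add₀ hw,
      neg_one_zpow_eq_of_sub_even (b := 5 * j + 2 - 2 * i + 1) ⟨-j - 1, by ring⟩,
      zpow_add_one₀ (by norm_num)]
    ring_nf
  rw [theta_mul_theta (hne 3) (hne 5) h5 (hne 12) (hne 20) h20,
    theta_mul_theta (hne 4) (hne 5) h5 (hne 16) (hne 20) h20,
    theta_mul_theta (neg_ne_zero.2 (hne 3)) (hne 4) h4 (hne 2) (hne 4) h4,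
    tsum_eq_sum_tsum_of_bijective
      (summable_thetaTerm_mul (hne 3) (hne 5) h5 (hne 12) (hne 20) h20) _ hbij,
    tsum_eq_sum_tsum_of_bijective
      (summable_thetaTerm_mul (hne 4) (hne 5) h5 (hne 16) (hne 20) h20) _ hbij,
    tsum_eq_sum_tsum_of_bijective
      (summable_thetaTerm_mul (neg_ne_zero.2 (hne 3)) (hne 4) h4 (hne 2) (hne 4) h4) _ hbij5,
    Fin.sum_univ_two, Fin.sum_univ_two, Fin.sum_univ_five, mul_add, ← tsum_mul_left,
    ← tsum_mul_left, ← add_assoc]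
  simp only [Matrix.cons_val]
  rw [hself, add_zero]
  have term_eq (m n k l : ℤ) (hs : Even (m + n - l))
      (he : 5 * m ^ 2 + m + 20 * n ^ 2 + 4 * n = 2 * (2 * k ^ 2 + k + 2 * l ^ 2)) :
      thetaTerm (w ^ 3) (w ^ 5) m * thetaTerm (w ^ 12) (w ^ 20) n =
        thetaTerm (-w ^ 3) (w ^ 4) k * thetaTerm (w ^ 2) (w ^ 4) l := by
    obtain ⟨a, ha⟩ := Int.even_mul_pred_self m
    rw [thetaTerm_pow hw (e := 3 * m + 5 * a) (by push_cast; rw [ha]; ring),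
      thetaTerm_pow hw (e := 10 * n ^ 2 + 2 * n) (by push_cast; ring),
      thetaTerm_neg_pow hw (e := 2 * k ^ 2 + k) (by push_cast; ring),
      thetaTerm_pow hw (e := 2 * l ^ 2) (by push_cast; ring), mul_mul_mul_comm,
      mul_left_comm (w ^ _), ← zpow_add₀ hw, ← zpow_add₀ hw, ← zpow_add₀ (by norm_num),
      neg_one_zpow_eq_of_sub_even hs]
    congr 2
    linarith
  have term_eq' (m n k l : ℤ) (hs : Even (m + n - l))
      (he : 5 * m ^ 2 + 3 * m + 20 * n ^ 2 + 12 * n + 2 = 2 * (2 * k ^ 2 + k + 2 * l ^ 2)) :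
      w * (thetaTerm (w ^ 4) (w ^ 5) m * thetaTerm (w ^ 16) (w ^ 20) n) =
        thetaTerm (-w ^ 3) (w ^ 4) k * thetaTerm (w ^ 2) (w ^ 4) l := by
    obtain ⟨a, ha⟩ := Int.even_mul_pred_self m
    rw [thetaTerm_pow hw (e := 4 * m + 5 * a) (by push_cast; rw [ha]; ring),
      thetaTerm_pow hw (e := 10 * n ^ 2 + 6 * n) (by push_cast; ring),
      thetaTerm_neg_pow hw (e := 2 * k ^ 2 + k) (by push_cast; ring),
      thetaTerm_pow hw (e := 2 * l ^ 2) (by push_cast; ring), mul_mul_mul_comm,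
      mul_left_comm (w ^ _), ← zpow_add₀ hw, ← zpow_add₀ hw, ← zpow_add₀ (by norm_num),
      neg_one_zpow_eq_of_sub_even hs, mul_left_comm, ← zpow_one_add₀ hw]
    congr 2
    linarith
  congr 1
  · congr 1
    · congr 1
      · exact tsum_congr fun ⟨i, j⟩ => term_eq _ _ _ _ ⟨2 * i, by ring⟩ (by ring)
      · exact tsum_congr fun ⟨i, j⟩ => term_eq _ _ _ _ ⟨j, by ring⟩ (by ring)
    · exact tsum_congr fun ⟨i, j⟩ => term_eq' _ _ _ _ ⟨j, by ring⟩ (by ring)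
  · exact tsum_congr fun ⟨i, j⟩ => term_eq' _ _ _ _ ⟨2 * i - 1, by ring⟩ (by ring)

theorem theta_pow_eq_qp {w : ℂ} (hw : w ≠ 0) (hw1 : ‖w‖ < 1) {a c m : ℕ} (h : a + c = m)
    (hm : m ≠ 0) :
    theta (w ^ a) (w ^ m) = qp (w ^ a) (w ^ m) * qp (w ^ c) (w ^ m) * qp (w ^ m) (w ^ m) := by
  rw [theta_eq_qp (pow_ne_zero a hw) (pow_ne_zero m hw) (norm_pow_lt_one hw1 hm),
    show w ^ m / w ^ a = w ^ c by
      rw [← h, pow_add, mul_div_cancel_left₀ _ (pow_ne_zero a hw)]]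

theorem qp_pow_eq_mul {q : ℂ} (hq : ‖q‖ < 1) (a : ℕ) {m : ℕ} (hm : m ≠ 0) :
    qp (q ^ a) (q ^ m) = qp (q ^ a) (q ^ (m * 2)) * qp (q ^ (a + m)) (q ^ (m * 2)) := by
  rw [qp_eq_prod_qp (q ^ a) (norm_pow_lt_one hq hm) two_ne_zero, Finset.prod_range_succ,
    Finset.prod_range_one, pow_zero, mul_one, pow_one, ← pow_add, ← pow_mul]

theorem qp_pow_eq_mul_five {q : ℂ} (hq : ‖q‖ < 1) (a : ℕ) {m : ℕ} (hm : m ≠ 0) :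
    qp (q ^ a) (q ^ m) = qp (q ^ a) (q ^ (m * 5)) * qp (q ^ (a + m)) (q ^ (m * 5)) *
      qp (q ^ (a + m * 2)) (q ^ (m * 5)) * qp (q ^ (a + m * 3)) (q ^ (m * 5)) *
      qp (q ^ (a + m * 4)) (q ^ (m * 5)) := by
  rw [qp_eq_prod_qp (q ^ a) (norm_pow_lt_one hq hm) (by norm_num : 5 ≠ 0)]
  simp only [Finset.prod_range_succ, Finset.prod_range_zero, one_mul, mul_zero, add_zero, mul_one,
    ← pow_add, ← pow_mul]

theorem qp_weierstrass {q : ℂ} (hq0 : q ≠ 0) (hq : ‖q‖ < 1) :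
    qp q (q ^ 10) * qp (q ^ 9) (q ^ 10) * (qp (q ^ 8) (q ^ 20) * qp (q ^ 12) (q ^ 20)) ^ 2 +
      q * (qp (q ^ 3) (q ^ 10) * qp (q ^ 7) (q ^ 10) *
        (qp (q ^ 4) (q ^ 20) * qp (q ^ 16) (q ^ 20)) ^ 2) =
      qp (q ^ 5) (q ^ 10) ^ 2 * (qp (q ^ 4) (q ^ 20) * qp (q ^ 16) (q ^ 20)) *
        (qp (q ^ 8) (q ^ 20) * qp (q ^ 12) (q ^ 20)) := by
  have h20 : ‖q ^ 20‖ < 1 := norm_pow_lt_one hq (by norm_num)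
  have hne : qp (q ^ 20) (q ^ 20) ≠ 0 := qp_ne_zero h20 h20
  have h := theta_three_term (pow_ne_zero 5 hq0) (pow_ne_zero 4 hq0) (pow_ne_zero 8 hq0)
    one_ne_zero (pow_ne_zero 20 hq0) h20
  rw [show q ^ 5 * q ^ 4 = q ^ 9 by ring, show q ^ 5 / q ^ 4 = q ^ 1 by field_simp,
    show q ^ 8 * q ^ 5 = q ^ 13 by ring, show q ^ 8 / q ^ 5 = q ^ 3 by field_simp,
    show q ^ 8 * q ^ 4 = q ^ 12 by ring, show q ^ 8 / q ^ 4 = q ^ 4 by field_simp] at h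
  simp only [mul_one, div_one] at h
  rw [theta_pow_eq_qp hq0 hq (a := 1) (c := 19) rfl (by norm_num),
    theta_pow_eq_qp hq0 hq (a := 3) (c := 17) rfl (by norm_num),
    theta_pow_eq_qp hq0 hq (a := 4) (c := 16) rfl (by norm_num),
    theta_pow_eq_qp hq0 hq (a := 5) (c := 15) rfl (by norm_num),
    theta_pow_eq_qp hq0 hq (a := 8) (c := 12) rfl (by norm_num),
    theta_pow_eq_qp hq0 hq (a := 9) (c := 11) rfl (by norm_num),
    theta_pow_eq_qp hq0 hq (a := 12) (c := 8) rfl (by norm_num),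
    theta_pow_eq_qp hq0 hq (a := 13) (c := 7) rfl (by norm_num)] at h
  have e1 := qp_pow_eq_mul hq 1 (m := 10) (by norm_num)
  have e3 := qp_pow_eq_mul hq 3 (m := 10) (by norm_num)
  have e5 := qp_pow_eq_mul hq 5 (m := 10) (by norm_num)
  have e7 := qp_pow_eq_mul hq 7 (m := 10) (by norm_num)
  have e9 := qp_pow_eq_mul hq 9 (m := 10) (by norm_num)
  norm_num only [pow_one] at e1 e3 e5 e7 e9 h
  rw [e1, e3, e5, e7, e9]
  refine mul_left_cancel₀ (mul_ne_zero (pow_ne_zero 4 hq0) (pow_ne_zero 4 hne)) ?_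
  linear_combination h

theorem qp_watson {q : ℂ} (hq0 : q ≠ 0) (hq : ‖q‖ < 1) :
    qp q (q ^ 10) * qp (q ^ 9) (q ^ 10) * (qp (q ^ 8) (q ^ 20) * qp (q ^ 12) (q ^ 20)) ^ 2 -
      q * (qp (q ^ 3) (q ^ 10) * qp (q ^ 7) (q ^ 10) *
        (qp (q ^ 4) (q ^ 20) * qp (q ^ 16) (q ^ 20)) ^ 2) =
      (qp (q ^ 4) (q ^ 20) * qp (q ^ 16) (q ^ 20) *
        (qp (q ^ 8) (q ^ 20) * qp (q ^ 12) (q ^ 20))) ^ 2 *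
      (qp q (q ^ 10) * qp (q ^ 3) (q ^ 10) * qp (q ^ 5) (q ^ 10) * qp (q ^ 7) (q ^ 10) *
        qp (q ^ 9) (q ^ 10)) ^ 2 *
      (qp (q ^ 2) (q ^ 20) * qp (q ^ 18) (q ^ 20) *
        (qp (q ^ 6) (q ^ 20) * qp (q ^ 14) (q ^ 20))) := by
  have hw0 : -q ≠ 0 := neg_ne_zero.2 hq0
  have hw : ‖-q‖ < 1 := by rwa [norm_neg]
  have hodd (a : ℕ) (ha : Odd a) :
      qp ((-q) ^ a) (q ^ 10) * qp (q ^ a) (q ^ 10) = qp (q ^ (a * 2)) (q ^ 20) := by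
    rw [ha.neg_pow, qp_neg_mul_qp _ (norm_pow_lt_one hq (by norm_num)), ← pow_mul, ← pow_mul]
  have ho {a : ℕ} (ha : a ≠ 0) : qp (q ^ a) (q ^ 10) ≠ 0 := qp_pow_ne_zero hq ha (by norm_num)
  have he {a : ℕ} (ha : a ≠ 0) : qp (q ^ a) (q ^ 20) ≠ 0 := qp_pow_ne_zero hq ha (by norm_num)
  have h := theta_watson hw0 hw
  have hpsi : theta (-(-q) ^ 3) ((-q) ^ 4) = theta (q ^ 3) (q ^ 4) := by
    congr 1 <;> ring
  rw [hpsi, theta_pow_eq_qp hw0 hw (a := 3) (c := 2) rfl (by norm_num),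
    theta_pow_eq_qp hw0 hw (a := 4) (c := 1) rfl (by norm_num),
    theta_pow_eq_qp hw0 hw (a := 12) (c := 8) rfl (by norm_num),
    theta_pow_eq_qp hw0 hw (a := 16) (c := 4) rfl (by norm_num),
    theta_pow_eq_qp hw0 hw (a := 2) (c := 2) rfl (by norm_num),
    theta_pow_eq_qp hq0 hq (a := 3) (c := 1) rfl (by norm_num),
    qp_pow_eq_mul hw 1 (m := 5) (by norm_num), qp_pow_eq_mul hw 2 (m := 5) (by norm_num),
    qp_pow_eq_mul hw 3 (m := 5) (by norm_num), qp_pow_eq_mul hw 4 (m := 5) (by norm_num),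
    qp_pow_eq_mul hw 5 (m := 5) (by norm_num), qp_pow_eq_mul_five hw 2 (m := 4) (by norm_num),
    qp_pow_eq_mul_five hw 4 (m := 4) (by norm_num),
    qp_pow_eq_mul_five hq 4 (m := 4) (by norm_num)] at h
  have hchi : qp (q ^ 3) (q ^ 4) * qp (q ^ 1) (q ^ 4) = qp (q ^ 1) (q ^ 10) * qp (q ^ 3) (q ^ 10) *
      qp (q ^ 5) (q ^ 10) * qp (q ^ 7) (q ^ 10) * qp (q ^ 9) (q ^ 10) := by
    have h1 := qp_pow_eq_mul_five hq 1 (m := 2) (by norm_num)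
    have h2 := qp_pow_eq_mul hq 1 (m := 2) (by norm_num)
    norm_num only at h1 h2
    rw [← h1, h2, mul_comm]
  rw [hchi] at h
  have heven (a : ℕ) (ha : Even a) : (-q) ^ a = q ^ a := ha.neg_pow q
  norm_num only at h
  rw [heven 2 ⟨1, rfl⟩, heven 4 ⟨2, rfl⟩, heven 6 ⟨3, rfl⟩, heven 8 ⟨4, rfl⟩, heven 10 ⟨5, rfl⟩,
    heven 12 ⟨6, rfl⟩, heven 14 ⟨7, rfl⟩, heven 16 ⟨8, rfl⟩, heven 18 ⟨9, rfl⟩,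
    heven 20 ⟨10, rfl⟩,
    eq_div_of_mul_eq (ho (by norm_num)) (hodd 1 (by decide)),
    eq_div_of_mul_eq (ho (by norm_num)) (hodd 3 (by decide)),
    eq_div_of_mul_eq (ho (by norm_num)) (hodd 5 (by decide)),
    eq_div_of_mul_eq (ho (by norm_num)) (hodd 7 (by decide)),
    eq_div_of_mul_eq (ho (by norm_num)) (hodd 9 (by decide)),
    qp_pow_eq_mul hq 2 (m := 10) (by norm_num),
    qp_pow_eq_mul hq 4 (m := 10) (by norm_num),
    qp_pow_eq_mul hq 6 (m := 10) (by norm_num),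
    qp_pow_eq_mul hq 8 (m := 10) (by norm_num),
    qp_pow_eq_mul hq 10 (m := 10) (by norm_num)] at h
  norm_num only [pow_one] at h
  have o1 := ho one_ne_zero
  have o3 := ho three_ne_zero
  have o5 := ho (a := 5) (by norm_num)
  have o7 := ho (a := 7) (by norm_num)
  have o9 := ho (a := 9) (by norm_num)
  have e2 := he two_ne_zero
  have e6 := he (a := 6) (by norm_num)
  have e10 := he (a := 10) (by norm_num)
  have e14 := he (a := 14) (by norm_num)
  have e18 := he (a := 18) (by norm_num)
  have e20 := he (a := 20) (by norm_num)
  rw [pow_one] at o1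
  refine mul_left_cancel₀ (mul_ne_zero (mul_ne_zero (mul_ne_zero e2 e6) (mul_ne_zero e14 e18))
    (mul_ne_zero (pow_ne_zero 2 e10) (pow_ne_zero 2 e20))) ?_
  field_simp at h ⊢
  linear_combination h

theorem stmt_12 : ∀ q : ℂ, ‖q‖ < 1 →
    R q * R (q ^ 2) / R (q ^ 4) ^ 2 - q ^ 2 * R (q ^ 4) ^ 2 / (R q * R (q ^ 2))
      = E q * E (q ^ 5) ^ 3 / E (q ^ 10) ^ 4 := by
  intro q hq
  rcases eq_or_ne q 0 with rfl | hq0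
  · simp [R, E, qp]
  have hE (a : ℂ) : E a = qp a a := by
    simp only [E, qp, pow_succ']
  have ho {a : ℕ} (ha : a ≠ 0) : qp (q ^ a) (q ^ 10) ≠ 0 := qp_pow_ne_zero hq ha (by norm_num)
  have he {a : ℕ} (ha : a ≠ 0) : qp (q ^ a) (q ^ 20) ≠ 0 := qp_pow_ne_zero hq ha (by norm_num)
  have hW := qp_weierstrass hq0 hq
  have hV := qp_watson hq0 hq
  have s1 := qp_pow_eq_mul hq 1 (m := 5) (by norm_num)
  have s2 := qp_pow_eq_mul hq 2 (m := 5) (by norm_num)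
  have s3 := qp_pow_eq_mul hq 3 (m := 5) (by norm_num)
  have s4 := qp_pow_eq_mul hq 4 (m := 5) (by norm_num)
  have s5 := qp_pow_eq_mul hq 5 (m := 5) (by norm_num)
  have sE := qp_pow_eq_mul_five hq 1 (m := 1) one_ne_zero
  have t2 := qp_pow_eq_mul hq 2 (m := 10) (by norm_num)
  have t4 := qp_pow_eq_mul hq 4 (m := 10) (by norm_num)
  have t6 := qp_pow_eq_mul hq 6 (m := 10) (by norm_num)
  have t8 := qp_pow_eq_mul hq 8 (m := 10) (by norm_num)
  norm_num only [pow_one] at s1 s2 s3 s4 s5 sE t2 t4 t6 t8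
  simp only [R, hE, ← pow_mul]
  norm_num only
  rw [sE, s1, s2, s3, s4, s5, t2, t4, t6, t8]
  have o1 := ho one_ne_zero
  rw [pow_one] at o1
  have o3 := ho three_ne_zero
  have o5 := ho (a := 5) (by norm_num)
  have o7 := ho (a := 7) (by norm_num)
  have o9 := ho (a := 9) (by norm_num)
  have o10 := ho (a := 10) (by norm_num)
  have e2 := he two_ne_zero
  have e4 := he four_ne_zero
  have e6 := he (a := 6) (by norm_num)
  have e8 := he (a := 8) (by norm_num)
  have e12 := he (a := 12) (by norm_num)
  have e14 := he (a := 14) (by norm_num)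
  have e16 := he (a := 16) (by norm_num)
  have e18 := he (a := 18) (by norm_num)
  have h := congrArg₂ (· * ·) hW hV
  field_simp
  linear_combination h
end

section
/- Let R(q) = (q,q^4;q^5)_∞/(q^2,q^3;q^5)_∞ and E(q)=(q;q)_∞. Then 1/(R(q) R(q^4)) + q^2 R(q) R(q^4) = 2q + E(q) E(q^4) E(q^{10})^{10}/(E(q^2)^2 E(q^5)^5 E(q^{20})^5). -/
open Filter Topology Finset

lemma summable_norm_geometric {q : ℂ} (hq : ‖q‖ < 1) (a : ℂ) :
    Summable fun k : ℕ ↦ ‖-(a * q ^ k)‖ := by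
  simpa [norm_mul, norm_pow] using (summable_geometric_of_lt_one (norm_nonneg q) hq).mul_left ‖a‖

lemma tendsto_prod_qp {q : ℂ} (hq : ‖q‖ < 1) (a : ℂ) :
    Tendsto (fun n ↦ ∏ k ∈ range n, (1 - a * q ^ k)) atTop (𝓝 (qp a q)) := by
  have h := (multipliable_one_add_of_summable (summable_norm_geometric hq a)).hasProd
  simpa only [qp, sub_eq_add_neg] using h.tendsto_prod_nat

lemma qp_ne_zero_s13 {q : ℂ} (hq : ‖q‖ < 1) {a : ℂ} (h : ∀ k : ℕ, a * q ^ k ≠ 1) : qp a q ≠ 0 := by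
  have := tprod_one_add_ne_zero_of_summable (f := fun k : ℕ ↦ -(a * q ^ k))
    (fun k ↦ by rw [← sub_eq_add_neg]; exact sub_ne_zero.2 (h k).symm)
    (summable_norm_geometric hq a)
  simpa only [qp, sub_eq_add_neg] using this

lemma qp_ne_zero_of_norm_lt {q : ℂ} (hq : ‖q‖ < 1) {a : ℂ} (ha : ‖a‖ < 1) : qp a q ≠ 0 := by
  refine qp_ne_zero_s13 hq fun k h ↦ ?_
  have h1 : ‖a‖ * ‖q‖ ^ k = 1 := by rw [← norm_pow, ← norm_mul, h, norm_one]
  have h2 : ‖q‖ ^ k ≤ 1 := pow_le_one₀ (norm_nonneg _) hq.le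
  nlinarith [norm_nonneg a]

lemma E_eq_qp (q : ℂ) : E q = qp q q := by
  simp only [E, qp, pow_succ']

lemma qp_eq_prod {q : ℂ} (hq : ‖q‖ < 1) (a : ℂ) {m : ℕ} (hm : m ≠ 0) :
    qp a q = ∏ j ∈ range m, qp (a * q ^ j) (q ^ m) := by
  have key : ∀ N, ∏ k ∈ range (m * N), (1 - a * q ^ k)
      = ∏ j ∈ range m, ∏ k ∈ range N, (1 - a * q ^ j * (q ^ m) ^ k) := by
    intro N
    induction N with
    | zero => simp
    | succ N ih =>
      simp only [Nat.mul_succ, prod_range_add, ih, prod_range_succ, prod_mul_distrib]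
      congr 1
      exact prod_congr rfl fun j _ ↦ by ring
  have hqm : ‖q ^ m‖ < 1 := by
    rw [norm_pow]; exact pow_lt_one₀ (norm_nonneg _) hq hm
  refine tendsto_nhds_unique
    ((tendsto_prod_qp hq a).comp (tendsto_id.const_mul_atTop' (Nat.pos_of_ne_zero hm))) ?_
  simp only [Function.comp_def, id, key]
  exact tendsto_finsetProd _ fun j _ ↦ tendsto_prod_qp hqm _

lemma qp_sq {q : ℂ} (hq : ‖q‖ < 1) (a : ℂ) : qp (a ^ 2) (q ^ 2) = qp a q * qp (-a) q := by
  have hq2 : ‖q ^ 2‖ < 1 := by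
    rw [norm_pow]; exact pow_lt_one₀ (norm_nonneg _) hq two_ne_zero
  refine tendsto_nhds_unique (tendsto_prod_qp hq2 _) ?_
  refine ((tendsto_prod_qp hq a).mul (tendsto_prod_qp hq (-a))).congr fun n ↦ ?_
  rw [← prod_mul_distrib]
  exact prod_congr rfl fun k _ ↦ by ring

lemma qp_eq_mul_qp {q : ℂ} (hq : ‖q‖ < 1) (a : ℂ) : qp a q = (1 - a) * qp (a * q) q := by
  refine tendsto_nhds_unique ((tendsto_prod_qp hq a).comp (tendsto_add_atTop_nat 1)) ?_
  refine ((tendsto_prod_qp hq (a * q)).const_mul (1 - a)).congr fun n ↦ ?_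
  simp only [Function.comp_def, prod_range_succ', pow_zero, mul_one]
  rw [mul_comm]
  congr 1
  exact prod_congr rfl fun k _ ↦ by ring

/-- The bilateral theta series `∑ p ^ (n (n - 1) / 2) z ^ n`. -/
noncomputable def thetaSeries (p z : ℂ) : ℂ := ∑' n : ℤ, p ^ (n * (n - 1) / 2) * z ^ n

lemma triangle_succ (n : ℤ) : (n + 1) * (n + 1 - 1) / 2 = n * (n - 1) / 2 + n := by
  rw [← Int.add_mul_ediv_right _ _ two_ne_zero]; congr 1; ring

lemma triangle_neg_succ (n : ℤ) :
    -(n + 1) * (-(n + 1) - 1) / 2 = -n * (-n - 1) / 2 + (n + 1) := by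
  rw [← Int.add_mul_ediv_right _ _ two_ne_zero]; congr 1; ring

lemma summable_norm_theta {p z : ℂ} (hp : ‖p‖ < 1) (hp0 : p ≠ 0) (hz : z ≠ 0) :
    Summable fun n : ℤ ↦ ‖p ^ (n * (n - 1) / 2) * z ^ n‖ := by
  have hne : ∀ n : ℤ, ‖p ^ (n * (n - 1) / 2) * z ^ n‖ ≠ 0 := fun n ↦
    norm_ne_zero_iff.2 (mul_ne_zero (zpow_ne_zero _ hp0) (zpow_ne_zero _ hz))
  have ht : Tendsto (fun n : ℕ ↦ ‖p‖ ^ n) atTop (𝓝 0) :=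
    tendsto_pow_atTop_nhds_zero_of_lt_one (norm_nonneg _) hp
  have hp' : ‖p‖ ≠ 0 := norm_ne_zero_iff.2 hp0
  have hz' : ‖z‖ ≠ 0 := norm_ne_zero_iff.2 hz
  refine Summable.of_nat_of_neg ?_ ?_
  · refine summable_of_ratio_test_tendsto_lt_one zero_lt_one (Eventually.of_forall fun n ↦ hne _) ?_
    have := ht.mul_const ‖z‖
    rw [zero_mul] at this
    refine this.congr fun n ↦ ?_
    rw [norm_norm, norm_norm, eq_div_iff (hne n)]
    push_cast
    rw [triangle_succ]
    simp only [norm_mul, norm_zpow, norm_pow, zpow_add₀ hp', zpow_add₀ hz', zpow_natCast, zpow_one]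
    ring_nf
  · refine summable_of_ratio_test_tendsto_lt_one zero_lt_one (Eventually.of_forall fun n ↦ hne _) ?_
    have := ht.mul_const (‖p‖ * ‖z‖⁻¹)
    rw [zero_mul] at this
    refine this.congr fun n ↦ ?_
    rw [norm_norm, norm_norm, eq_div_iff (hne _)]
    push_cast
    rw [triangle_neg_succ, neg_add (n : ℤ) 1]
    simp only [norm_mul, norm_zpow, norm_pow, zpow_add₀ hp', zpow_add₀ hz', zpow_natCast, zpow_one,
      zpow_neg, norm_inv]
    ring_nf

/-- `∏_{k < n} (1 - p ^ (k + 1))⁻¹` for `n ≥ 0`, extended by `0` to negative integers. -/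
noncomputable def qfactInv (p : ℂ) (n : ℤ) : ℂ :=
  if n < 0 then 0 else (∏ k ∈ range n.toNat, (1 - p * p ^ k))⁻¹

lemma one_sub_pow_succ_ne_zero {p : ℂ} (hp : ‖p‖ < 1) (k : ℕ) : 1 - p * p ^ k ≠ 0 := by
  intro h
  have h1 : ‖p ^ (k + 1)‖ = 1 := by rw [pow_succ', ← sub_eq_zero.1 h, norm_one]
  rw [norm_pow] at h1
  exact absurd h1 (pow_lt_one₀ (norm_nonneg _) hp (Nat.succ_ne_zero k)).ne

lemma qfactInv_eq {p : ℂ} (hp : ‖p‖ < 1) (n : ℤ) :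
    qfactInv p n = (1 - p ^ (n + 1)) * qfactInv p (n + 1) := by
  rcases lt_trichotomy n (-1) with h | rfl | h
  · simp [qfactInv, show n < 0 by omega, show n + 1 < 0 by omega]
  · simp [qfactInv]
  · obtain ⟨m, rfl⟩ := Int.eq_ofNat_of_zero_le (show 0 ≤ n by omega)
    have h1 := one_sub_pow_succ_ne_zero hp m
    have h2 : p ^ ((m : ℤ) + 1) = p * p ^ m := by
      rw [← pow_succ', ← zpow_natCast]; norm_cast
    have h3 : ((m : ℤ) + 1).toNat = m + 1 := by omega
    rw [h2]
    simp only [qfactInv, show ¬ ((m : ℤ) < 0) by omega, show ¬ ((m : ℤ) + 1 < 0) by omega, if_false,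
      h3, Int.toNat_natCast, prod_range_succ, mul_inv]
    field_simp

/-- The finite form of the Jacobi triple product. -/
lemma hasSum_finite_triple {p z : ℂ} (hp : ‖p‖ < 1) (hp0 : p ≠ 0) (hz : z ≠ 0) (n : ℕ) :
    HasSum (fun j : ℤ ↦ (∏ k ∈ range (2 * n), (1 - p * p ^ k)) * qfactInv p (n - j) *
        qfactInv p (n + j) * (p ^ (j * (j - 1) / 2) * (-z) ^ j))
      (∏ k ∈ range n, (1 - z * p ^ k) * (1 - p / z * p ^ k)) := by
  induction n with
  | zero =>
    convert hasSum_single (0 : ℤ) ?_ using 1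
    · simp [qfactInv]
    · intro j hj
      rcases lt_or_gt_of_ne hj with h | h
      · simp [qfactInv, h]
      · simp [qfactInv, h]
  | succ n ih =>
    have h1 := ih.mul_left (1 + p ^ (2 * n + 1))
    have h2 := ((Equiv.addRight (-1 : ℤ)).hasSum_iff.2 ih).mul_left (z * p ^ n)
    have h3 := ((Equiv.addRight (1 : ℤ)).hasSum_iff.2 ih).mul_left (p ^ (n + 1) / z)
    have hv : ∏ k ∈ range (n + 1), (1 - z * p ^ k) * (1 - p / z * p ^ k) =
        (1 + p ^ (2 * n + 1)) * ∏ k ∈ range n, (1 - z * p ^ k) * (1 - p / z * p ^ k) -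
        z * p ^ n * ∏ k ∈ range n, (1 - z * p ^ k) * (1 - p / z * p ^ k) -
        p ^ (n + 1) / z * ∏ k ∈ range n, (1 - z * p ^ k) * (1 - p / z * p ^ k) := by
      rw [prod_range_succ]
      field_simp
      ring_nf
    rw [hv]
    refine Eq.subst (motive := fun f ↦ HasSum f _) (funext fun j ↦ Eq.symm ?_)
      ((h1.sub h2).sub h3)
    have hz' : -z ≠ 0 := neg_ne_zero.2 hz
    have e1 := triangle_succ j
    have e2 := triangle_succ (j - 1)
    simp only [sub_add_cancel] at e2
    simp only [Function.comp_def, Equiv.coe_addRight, ← sub_eq_add_neg, e1]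
    rw [show (n : ℤ) - (j - 1) = n - j + 1 by ring, show (n : ℤ) + (j - 1) = n + j - 1 by ring,
      show (n : ℤ) - (j + 1) = n - j - 1 by ring, show (n : ℤ) + (j + 1) = n + j + 1 by ring,
      show ((n + 1 : ℕ) : ℤ) - j = n - j + 1 by push_cast; ring,
      show ((n + 1 : ℕ) : ℤ) + j = n + j + 1 by push_cast; ring]
    have a1 := qfactInv_eq hp (n - j)
    have a2 := qfactInv_eq hp (n - j - 1)
    have b1 := qfactInv_eq hp (n + j)
    have b2 := qfactInv_eq hp (n + j - 1)
    simp only [sub_add_cancel] at a2 b2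
    rw [a2, b2, a1, b1, e2]
    rw [show 2 * (n + 1) = 2 * n + 1 + 1 by ring, prod_range_succ, prod_range_succ]
    simp only [zpow_add₀ hp0, zpow_sub₀ hp0, zpow_add₀ hz', zpow_sub₀ hz', zpow_one,
      zpow_natCast]
    have hj : p ^ j ≠ 0 := zpow_ne_zero _ hp0
    field_simp
    ring

lemma tendsto_qfactInv {p : ℂ} (hp : ‖p‖ < 1) :
    Tendsto (qfactInv p) atTop (𝓝 (qp p p)⁻¹) := by
  have h := ((tendsto_prod_qp hp p).inv₀ (qp_ne_zero_of_norm_lt hp hp)).comp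
    (tendsto_atTop_atTop.2 fun b ↦ ⟨(b : ℤ), fun a h ↦ by omega⟩ : Tendsto Int.toNat atTop atTop)
  refine h.congr' ?_
  filter_upwards [eventually_ge_atTop 0] with n hn
  simp [qfactInv, hn.not_gt]

lemma exists_norm_qfactInv_le {p : ℂ} (hp : ‖p‖ < 1) : ∃ C, ∀ n, ‖qfactInv p n‖ ≤ C := by
  obtain ⟨C, hC⟩ := (Metric.isBounded_range_of_tendsto _
    ((tendsto_qfactInv hp).comp tendsto_natCast_atTop_atTop)).exists_norm_le
  refine ⟨C, fun n ↦ ?_⟩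
  rcases lt_or_ge n 0 with h | h
  · have := hC _ ⟨0, rfl⟩
    simpa [qfactInv, h] using (norm_nonneg _).trans this
  · lift n to ℕ using h
    exact hC _ ⟨n, rfl⟩

/-- The Jacobi triple product identity. -/
lemma qp_mul_qp_eq_thetaSeries {p z : ℂ} (hp : ‖p‖ < 1) (hp0 : p ≠ 0) (hz : z ≠ 0) :
    qp z p * qp (p / z) p = (qp p p)⁻¹ * thetaSeries p (-z) := by
  have he := qp_ne_zero_of_norm_lt hp hp
  obtain ⟨C, hC⟩ := exists_norm_qfactInv_le hp
  have hfin := (tendsto_prod_qp hp p).comp (tendsto_id.const_mul_atTop' (zero_lt_two (α := ℕ)))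
  obtain ⟨M, hM⟩ := (Metric.isBounded_range_of_tendsto _ hfin).exists_norm_le
  have hM' : ∀ n, ‖∏ k ∈ range (2 * n), (1 - p * p ^ k)‖ ≤ M := fun n ↦ hM _ ⟨n, rfl⟩
  have hM0 : 0 ≤ M := (norm_nonneg _).trans (hM' 0)
  have hC0 : 0 ≤ C := (norm_nonneg _).trans (hC 0)
  have h1 := tendsto_tsum_of_dominated_convergence (𝓕 := atTop)
    (f := fun (n : ℕ) (j : ℤ) ↦ (∏ k ∈ range (2 * n), (1 - p * p ^ k)) * qfactInv p (n - j) *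
        qfactInv p (n + j) * (p ^ (j * (j - 1) / 2) * (-z) ^ j))
    (g := fun j ↦ qp p p * (qp p p)⁻¹ * (qp p p)⁻¹ * (p ^ (j * (j - 1) / 2) * (-z) ^ j))
    ((summable_norm_theta hp hp0 (neg_ne_zero.2 hz)).mul_left (M * C * C)) ?_ ?_
  · simp only [(hasSum_finite_triple hp hp0 hz _).tsum_eq, tsum_mul_left,
      prod_mul_distrib] at h1
    rw [mul_inv_cancel₀ he, one_mul] at h1
    exact tendsto_nhds_unique ((tendsto_prod_qp hp z).mul (tendsto_prod_qp hp (p / z))) h1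
  · intro j
    refine ((hfin.mul ?_).mul ?_).mul_const _
    · exact (tendsto_qfactInv hp).comp
        (tendsto_atTop_add_const_right _ (-j) tendsto_natCast_atTop_atTop)
    · exact (tendsto_qfactInv hp).comp
        (tendsto_atTop_add_const_right _ j tendsto_natCast_atTop_atTop)
  · refine Eventually.of_forall fun n j ↦ ?_
    rw [norm_mul, norm_mul, norm_mul]
    gcongr
    · exact hM' n
    · exact hC _
    · exact hC _

lemma triangle_mul_two (n : ℤ) : n * (n - 1) / 2 * 2 = n * (n - 1) :=
  Int.ediv_mul_cancel (Int.even_mul_pred_self n).two_dvd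

lemma triangle_add (s d : ℤ) :
    (s + d) * (s + d - 1) / 2 + (s - d) * (s - d - 1) / 2
      = 2 * (s * (s - 1) / 2) + (2 * (d * (d - 1) / 2) + d) := by
  have := triangle_mul_two (s + d)
  have := triangle_mul_two (s - d)
  have := triangle_mul_two s
  have := triangle_mul_two d
  linarith

lemma triangle_add_odd (s d : ℤ) :
    (s + d) * (s + d - 1) / 2 + (s - d + 1) * (s - d + 1 - 1) / 2
      = (2 * (s * (s - 1) / 2) + s) + 2 * (d * (d - 1) / 2) := by
  have := triangle_mul_two (s + d)
  have := triangle_mul_two (s - d + 1)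
  have := triangle_mul_two s
  have := triangle_mul_two d
  linarith

/-- Integer pairs, split by the parity of the sum of the entries. -/
noncomputable def paritySplit : (ℤ × ℤ) ⊕ (ℤ × ℤ) ≃ ℤ × ℤ :=
  Equiv.ofBijective
    (Sum.elim (fun x ↦ (x.1 + x.2, x.1 - x.2)) (fun x ↦ (x.1 + x.2, x.1 - x.2 + 1))) (by
    constructor
    · rintro (⟨a, b⟩ | ⟨a, b⟩) (⟨c, d⟩ | ⟨c, d⟩) h <;>
        simp only [Sum.elim_inl, Sum.elim_inr, Prod.mk.injEq, Sum.inl.injEq, Sum.inr.injEq,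
          reduceCtorEq] at h ⊢ <;> omega
    · rintro ⟨m, n⟩
      rcases Int.even_or_odd' (m + n) with ⟨k, hk | hk⟩
      · exact ⟨Sum.inl (k, m - k), by simp; omega⟩
      · exact ⟨Sum.inr (k, m - k), by simp; omega⟩)

lemma paritySplit_inl (s d : ℤ) : paritySplit (Sum.inl (s, d)) = (s + d, s - d) := rfl

lemma paritySplit_inr (s d : ℤ) : paritySplit (Sum.inr (s, d)) = (s + d, s - d + 1) := rfl

lemma thetaSeries_mul {p x y : ℂ} (hp : ‖p‖ < 1) (hp0 : p ≠ 0) (hx : x ≠ 0) (hy : y ≠ 0) :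
    thetaSeries p (-(x * y)) * thetaSeries p (-(x / y)) =
      thetaSeries (p ^ 2) (x ^ 2) * thetaSeries (p ^ 2) (p * y ^ 2)
        - x / y * (thetaSeries (p ^ 2) (p * x ^ 2) * thetaSeries (p ^ 2) (y ^ 2)) := by
  have hp2 : ‖p ^ 2‖ < 1 := by rw [norm_pow]; exact pow_lt_one₀ (norm_nonneg _) hp two_ne_zero
  have hp20 : p ^ 2 ≠ 0 := pow_ne_zero _ hp0
  have hx2 : x ^ 2 ≠ 0 := pow_ne_zero _ hx
  have hy2 : y ^ 2 ≠ 0 := pow_ne_zero _ hy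
  have sxy := summable_norm_theta hp hp0 (neg_ne_zero.2 (mul_ne_zero hx hy))
  have sxdy := summable_norm_theta hp hp0 (neg_ne_zero.2 (div_ne_zero hx hy))
  have sx := summable_norm_theta hp2 hp20 hx2
  have sy := summable_norm_theta hp2 hp20 hy2
  have spx := summable_norm_theta hp2 hp20 (mul_ne_zero hp0 hx2)
  have spy := summable_norm_theta hp2 hp20 (mul_ne_zero hp0 hy2)
  simp only [thetaSeries]
  rw [tsum_mul_tsum_of_summable_norm sxy sxdy, tsum_mul_tsum_of_summable_norm sx spy,
    tsum_mul_tsum_of_summable_norm spx sy, ← tsum_mul_left, ← paritySplit.tsum_eq]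
  have h1 := summable_mul_of_summable_norm sx spy
  have h2 := ((summable_mul_of_summable_norm spx sy).mul_left (x / y)).neg
  rw [sub_eq_add_neg, ← tsum_neg]
  have e1 : ∀ s d : ℤ, (-(x * y)) ^ (s + d) * (-(x / y)) ^ (s - d) = (x ^ 2) ^ s * (y ^ 2) ^ d := by
    intro s d
    have hxy := neg_ne_zero.2 (mul_ne_zero hx hy)
    have hxdy := neg_ne_zero.2 (div_ne_zero hx hy)
    rw [zpow_add₀ hxy, zpow_sub₀ hxdy,
      show x ^ 2 = -(x * y) * -(x / y) by field_simp, mul_zpow,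
      show y ^ 2 = -(x * y) / -(x / y) by field_simp, div_zpow]
    ring
  have e2 : ∀ s d : ℤ, (-(x * y)) ^ (s + d) * (-(x / y)) ^ (s - d + 1) =
      -(x / y) * ((x ^ 2) ^ s * (y ^ 2) ^ d) := by
    intro s d
    rw [zpow_add_one₀ (neg_ne_zero.2 (div_ne_zero hx hy)), ← e1]
    ring
  have pz : ∀ n : ℤ, (p ^ 2) ^ n = p ^ (2 * n) := fun n ↦ by rw [zpow_mul]; norm_cast
  have f1 : ((fun z : ℤ × ℤ ↦ p ^ (z.1 * (z.1 - 1) / 2) * (-(x * y)) ^ z.1 *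
      (p ^ (z.2 * (z.2 - 1) / 2) * (-(x / y)) ^ z.2)) ∘ paritySplit) ∘ Sum.inl =
      fun z ↦ (p ^ 2) ^ (z.1 * (z.1 - 1) / 2) * (x ^ 2) ^ z.1 *
        ((p ^ 2) ^ (z.2 * (z.2 - 1) / 2) * (p * y ^ 2) ^ z.2) := by
    funext ⟨s, d⟩
    have h := congrArg (p ^ ·) (triangle_add s d)
    simp only [zpow_add₀ hp0] at h
    simp only [Function.comp_def, paritySplit_inl, pz, mul_zpow p]
    linear_combination (-(x * y)) ^ (s + d) * (-(x / y)) ^ (s - d) * h +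
      p ^ (2 * (s * (s - 1) / 2)) * p ^ (2 * (d * (d - 1) / 2)) * p ^ d * e1 s d
  have f2 : ((fun z : ℤ × ℤ ↦ p ^ (z.1 * (z.1 - 1) / 2) * (-(x * y)) ^ z.1 *
      (p ^ (z.2 * (z.2 - 1) / 2) * (-(x / y)) ^ z.2)) ∘ paritySplit) ∘ Sum.inr =
      fun z ↦ -(x / y * ((p ^ 2) ^ (z.1 * (z.1 - 1) / 2) * (p * x ^ 2) ^ z.1 *
        ((p ^ 2) ^ (z.2 * (z.2 - 1) / 2) * (y ^ 2) ^ z.2))) := by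
    funext ⟨s, d⟩
    have h := congrArg (p ^ ·) (triangle_add_odd s d)
    simp only [zpow_add₀ hp0] at h
    simp only [Function.comp_def, paritySplit_inr, pz, mul_zpow p]
    linear_combination (-(x * y)) ^ (s + d) * (-(x / y)) ^ (s - d + 1) * h +
      p ^ (2 * (s * (s - 1) / 2)) * p ^ (2 * (d * (d - 1) / 2)) * p ^ s * e2 s d
  have g1 := h1.hasSum
  have g2 := h2.hasSum
  rw [← f1] at g1
  rw [← f2] at g2
  have g := (HasSum.sum g1 g2).tsum_eq
  rw [f1, f2] at g
  exact g

/-- The theta product `(z; p)_∞ (p / z; p)_∞`. -/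
noncomputable def thetaProd (p z : ℂ) : ℂ := qp z p * qp (p / z) p

/-- The addition formula behind the Weierstrass three-term relation for theta products. -/
lemma exists_thetaProd_mul {p : ℂ} (hp : ‖p‖ < 1) (hp0 : p ≠ 0) :
    ∃ A B : ℂ → ℂ, ∀ x y, x ≠ 0 → y ≠ 0 →
      thetaProd p (x * y) * thetaProd p (x / y) = x * (A x * B y - B x * A y) := by
  refine ⟨fun x ↦ (qp p p)⁻¹ * (thetaSeries (p ^ 2) (x ^ 2) / x),
    fun x ↦ (qp p p)⁻¹ * thetaSeries (p ^ 2) (p * x ^ 2), fun x y hx hy ↦ ?_⟩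
  simp only [thetaProd]
  rw [qp_mul_qp_eq_thetaSeries hp hp0 (mul_ne_zero hx hy),
    qp_mul_qp_eq_thetaSeries hp hp0 (div_ne_zero hx hy)]
  have := thetaSeries_mul hp hp0 hx hy
  have he := qp_ne_zero_of_norm_lt hp hp
  field_simp
  field_simp at this
  linear_combination this

lemma thetaProd_div {p z : ℂ} (hp0 : p ≠ 0) : thetaProd p (p / z) = thetaProd p z := by
  rw [thetaProd, thetaProd, div_div_cancel₀ hp0, mul_comm]

lemma thetaProd_neg_one {p : ℂ} (hp : ‖p‖ < 1) : thetaProd p (-1) = 2 * qp (-p) p ^ 2 := by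
  rw [thetaProd, qp_eq_mul_qp hp (-1), div_neg, div_one, neg_one_mul]
  ring

lemma thetaProd_mul_sub {r : ℂ} (hr : ‖r‖ < 1) (hr0 : r ≠ 0) :
    thetaProd (r ^ 20) (r ^ 10) * thetaProd (r ^ 20) (-1) *
      (thetaProd (r ^ 20) (r ^ 6) * thetaProd (r ^ 20) (-r ^ 8) -
        r ^ 2 * (thetaProd (r ^ 20) (r ^ 2) * thetaProd (r ^ 20) (-r ^ 4))) =
      2 * (thetaProd (r ^ 20) (r ^ 2) * thetaProd (r ^ 20) (r ^ 6) *
        thetaProd (r ^ 20) (-r ^ 4) * thetaProd (r ^ 20) (-r ^ 8)) := by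
  have hp : ‖r ^ 20‖ < 1 := by
    rw [norm_pow]; exact pow_lt_one₀ (norm_nonneg _) hr (by norm_num)
  have hp0 : r ^ 20 ≠ 0 := pow_ne_zero _ hr0
  obtain ⟨A, B, hAB⟩ := exists_thetaProd_mul hp hp0
  have c12 : thetaProd (r ^ 20) (r ^ 12) = thetaProd (r ^ 20) (r ^ 8) := by
    rw [← thetaProd_div hp0 (z := r ^ 8)]; congr 1; field_simp
  have c12' : thetaProd (r ^ 20) (-r ^ 12) = thetaProd (r ^ 20) (-r ^ 8) := by
    rw [← thetaProd_div hp0 (z := -r ^ 8)]; congr 1; field_simp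
  set θ := thetaProd (r ^ 20)
  have hI := Complex.I_ne_zero
  have hI2 : Complex.I ^ 2 = -1 := Complex.I_sq
  have key : ∀ x y s t : ℂ, x ≠ 0 → y ≠ 0 → x * y = s → x = t * y →
      θ s * θ t = x * (A x * B y - B x * A y) := by
    intro x y s t hx hy h1 h2
    rw [← hAB x y hx hy, h1, h2, mul_div_cancel_right₀ _ hy]
  have n1 : Complex.I * r ≠ 0 := mul_ne_zero hI hr0
  have n3 : Complex.I * r ^ 3 ≠ 0 := mul_ne_zero hI (pow_ne_zero _ hr0)
  have n5 : Complex.I * r ^ 5 ≠ 0 := mul_ne_zero hI (pow_ne_zero _ hr0)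
  have n7 : Complex.I * r ^ 7 ≠ 0 := mul_ne_zero hI (pow_ne_zero _ hr0)
  have m1 := neg_ne_zero.2 n1
  have m3 := neg_ne_zero.2 n3
  have m5 := neg_ne_zero.2 n5
  have k0 := key _ _ (r ^ 10) (-1) n5 m5 (by linear_combination (-r ^ 10) * hI2) (by ring)
  have i1 := key _ _ (r ^ 6) (-r ^ 4) n5 m1 (by linear_combination (-r ^ 6) * hI2) (by ring)
  have i2 := key _ _ (-r ^ 8) (r ^ 2) m5 m3 (by linear_combination (r ^ 8) * hI2) (by ring)
  have i3 := key _ _ (-r ^ 4) (r ^ 2) m3 m1 (by linear_combination (r ^ 4) * hI2) (by ring)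
  have i4 := key _ _ (r ^ 8) (-r ^ 2) n5 m3 (by linear_combination (-r ^ 8) * hI2) (by ring)
  have i5 := key _ _ (-r ^ 6) (r ^ 4) m5 m1 (by linear_combination (r ^ 6) * hI2) (by ring)
  have j1 := key _ _ (-r ^ 12) (r ^ 2) n7 n5 (by linear_combination (r ^ 12) * hI2) (by ring)
  have j2 := key _ _ (r ^ 6) (-r ^ 4) m5 n1 (by linear_combination (-r ^ 6) * hI2) (by ring)
  have j3 := key _ _ (-r ^ 8) (r ^ 6) n7 n1 (by linear_combination (r ^ 8) * hI2) (by ring)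
  have j4 := key _ _ (-r ^ 6) (r ^ 4) n5 n1 (by linear_combination (r ^ 6) * hI2) (by ring)
  have j5 := key _ _ (r ^ 12) (-r ^ 2) n7 m5 (by linear_combination (-r ^ 12) * hI2) (by ring)
  rw [c12'] at j1
  rw [c12] at j5
  have hII : (θ (r ^ 6) * θ (-r ^ 4)) * (θ (-r ^ 8) * θ (r ^ 2)) +
      r ^ 2 * ((θ (r ^ 10) * θ (-1)) * (θ (-r ^ 4) * θ (r ^ 2))) =
      (θ (r ^ 8) * θ (-r ^ 2)) * (θ (-r ^ 6) * θ (r ^ 4)) := by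
    rw [i1, i2, i3, i4, i5, k0]; ring
  have hI' : (θ (r ^ 10) * θ (-1)) * (θ (-r ^ 8) * θ (r ^ 6)) =
      (θ (-r ^ 8) * θ (r ^ 2)) * (θ (r ^ 6) * θ (-r ^ 4)) +
      (θ (-r ^ 6) * θ (r ^ 4)) * (θ (r ^ 12) * θ (-r ^ 2)) := by
    rw [c12, j1, j2, j3, j4, j5, k0]; ring
  rw [c12] at hI'
  linear_combination hI' - hII

lemma qp_pow_identity {q : ℂ} (hq : ‖q‖ < 1) (hq0 : q ≠ 0) :
    qp (q ^ 5) (q ^ 10) ^ 2 * qp (-q ^ 10) (q ^ 10) ^ 2 *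
      (qp (q ^ 3) (q ^ 10) * qp (q ^ 7) (q ^ 10) * (qp (-q ^ 4) (q ^ 10) * qp (-q ^ 6) (q ^ 10)) -
        q * (qp q (q ^ 10) * qp (q ^ 9) (q ^ 10) *
          (qp (-q ^ 2) (q ^ 10) * qp (-q ^ 8) (q ^ 10)))) =
      qp q (q ^ 10) * qp (q ^ 9) (q ^ 10) * (qp (-q ^ 2) (q ^ 10) * qp (-q ^ 8) (q ^ 10)) *
      (qp (q ^ 3) (q ^ 10) * qp (q ^ 7) (q ^ 10) *
        (qp (-q ^ 4) (q ^ 10) * qp (-q ^ 6) (q ^ 10))) := by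
  obtain ⟨r, rfl⟩ := IsAlgClosed.exists_pow_nat_eq q two_pos
  have hr0 : r ≠ 0 := by rintro rfl; simp at hq0
  have hr : ‖r‖ < 1 := by
    rw [norm_pow] at hq
    exact (pow_lt_one_iff_of_nonneg (norm_nonneg _) two_ne_zero).1 hq
  have hp : ‖r ^ 20‖ < 1 := by
    rw [norm_pow]; exact pow_lt_one₀ (norm_nonneg _) hr (by norm_num)
  have h := thetaProd_mul_sub hr hr0
  rw [thetaProd_neg_one hp] at h
  simp only [thetaProd, div_neg,
    show r ^ 20 / r ^ 10 = r ^ 10 by field_simp, show r ^ 20 / r ^ 6 = r ^ 14 by field_simp,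
    show r ^ 20 / r ^ 8 = r ^ 12 by field_simp, show r ^ 20 / r ^ 2 = r ^ 18 by field_simp,
    show r ^ 20 / r ^ 4 = r ^ 16 by field_simp] at h
  simp only [← pow_mul, Nat.reduceMul]
  linear_combination h / 2

theorem stmt_13 : ∀ q : ℂ, ‖q‖ < 1 →
    1 / (R q * R (q ^ 4)) + q ^ 2 * R q * R (q ^ 4)
      = 2 * q + E q * E (q ^ 4) * E (q ^ 10) ^ 10 / (E (q ^ 2) ^ 2 * E (q ^ 5) ^ 5 * E (q ^ 20) ^ 5) := by
  intro q hq
  rcases eq_or_ne q 0 with rfl | hq0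
  · simp [R, E, qp]
  have hn : ∀ m : ℕ, m ≠ 0 → ‖q ^ m‖ < 1 := fun m hm ↦ by
    rw [norm_pow]; exact pow_lt_one₀ (norm_nonneg _) hq hm
  have hp := hn 10 (by norm_num)
  have ne : ∀ m : ℕ, m ≠ 0 → qp (q ^ m) (q ^ 10) ≠ 0 := fun m hm ↦
    qp_ne_zero_of_norm_lt hp (hn m hm)
  have ne' : ∀ m : ℕ, m ≠ 0 → qp (-q ^ m) (q ^ 10) ≠ 0 := fun m hm ↦
    qp_ne_zero_of_norm_lt hp (by rw [norm_neg]; exact hn m hm)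
  have five : ∀ a, qp a (q ^ 5) = qp a (q ^ 10) * qp (a * q ^ 5) (q ^ 10) := fun a ↦ by
    rw [qp_eq_prod (hn 5 (by norm_num)) a two_ne_zero]
    simp [prod_range_succ, ← pow_mul]
  have twenty : ∀ m : ℕ, qp (q ^ (2 * m)) (q ^ 20) = qp (q ^ m) (q ^ 10) * qp (-q ^ m) (q ^ 10) :=
    fun m ↦ by rw [← qp_sq hp, ← pow_mul, ← pow_mul, mul_comm m]
  have hR : R q = qp q (q ^ 10) * qp (q ^ 6) (q ^ 10) * (qp (q ^ 4) (q ^ 10) * qp (q ^ 9) (q ^ 10)) /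
      (qp (q ^ 2) (q ^ 10) * qp (q ^ 7) (q ^ 10) *
        (qp (q ^ 3) (q ^ 10) * qp (q ^ 8) (q ^ 10))) := by
    simp only [R, five, ← pow_add, ← pow_succ', Nat.reduceAdd]
  have hR4 : R (q ^ 4) = qp (q ^ 2) (q ^ 10) * qp (-q ^ 2) (q ^ 10) *
      (qp (q ^ 8) (q ^ 10) * qp (-q ^ 8) (q ^ 10)) /
      (qp (q ^ 4) (q ^ 10) * qp (-q ^ 4) (q ^ 10) *
        (qp (q ^ 6) (q ^ 10) * qp (-q ^ 6) (q ^ 10))) := by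
    simp only [R, ← pow_mul, Nat.reduceMul, ← twenty]
  have hE1 : E q = qp q (q ^ 10) * qp (q ^ 2) (q ^ 10) * qp (q ^ 3) (q ^ 10) *
      qp (q ^ 4) (q ^ 10) * qp (q ^ 5) (q ^ 10) * qp (q ^ 6) (q ^ 10) * qp (q ^ 7) (q ^ 10) *
      qp (q ^ 8) (q ^ 10) * qp (q ^ 9) (q ^ 10) * qp (q ^ 10) (q ^ 10) := by
    rw [E_eq_qp, qp_eq_prod hq q (show 10 ≠ 0 by norm_num)]
    simp only [prod_range_succ, prod_range_zero, ← pow_succ', Nat.reduceAdd, zero_add, pow_one,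
      one_mul]
  have hE2 : E (q ^ 2) = qp (q ^ 2) (q ^ 10) * qp (q ^ 4) (q ^ 10) * qp (q ^ 6) (q ^ 10) *
      qp (q ^ 8) (q ^ 10) * qp (q ^ 10) (q ^ 10) := by
    rw [E_eq_qp, qp_eq_prod (hn 2 two_ne_zero) _ (show 5 ≠ 0 by norm_num)]
    simp only [prod_range_succ, prod_range_zero, ← pow_mul, ← pow_add, Nat.reduceAdd,
      Nat.reduceMul, one_mul]
  have hE4 : E (q ^ 4) = qp (q ^ 2) (q ^ 10) * qp (-q ^ 2) (q ^ 10) *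
      (qp (q ^ 4) (q ^ 10) * qp (-q ^ 4) (q ^ 10)) *
      (qp (q ^ 6) (q ^ 10) * qp (-q ^ 6) (q ^ 10)) *
      (qp (q ^ 8) (q ^ 10) * qp (-q ^ 8) (q ^ 10)) *
      (qp (q ^ 10) (q ^ 10) * qp (-q ^ 10) (q ^ 10)) := by
    rw [E_eq_qp, qp_eq_prod (hn 4 (by norm_num)) _ (show 5 ≠ 0 by norm_num)]
    simp only [prod_range_succ, prod_range_zero, ← pow_mul, ← pow_add, Nat.reduceAdd,
      Nat.reduceMul, one_mul, ← twenty]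
  have hE5 : E (q ^ 5) = qp (q ^ 5) (q ^ 10) * qp (q ^ 10) (q ^ 10) := by
    rw [E_eq_qp, five, ← pow_add]
  have hE20 : E (q ^ 20) = qp (q ^ 10) (q ^ 10) * qp (-q ^ 10) (q ^ 10) := by
    rw [E_eq_qp, ← twenty]
  have h := qp_pow_identity hq hq0
  rw [hR, hR4, hE1, hE2, hE4, hE5, hE20, E_eq_qp]
  have n1 : qp q (q ^ 10) ≠ 0 := qp_ne_zero_of_norm_lt hp hq
  have n2 := ne 2 (by norm_num)
  have n3 := ne 3 (by norm_num)
  have n4 := ne 4 (by norm_num)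
  have n5 := ne 5 (by norm_num)
  have n6 := ne 6 (by norm_num)
  have n7 := ne 7 (by norm_num)
  have n8 := ne 8 (by norm_num)
  have n9 := ne 9 (by norm_num)
  have n10 := ne 10 (by norm_num)
  have m2 := ne' 2 (by norm_num)
  have m4 := ne' 4 (by norm_num)
  have m6 := ne' 6 (by norm_num)
  have m8 := ne' 8 (by norm_num)
  have m10 := ne' 10 (by norm_num)
  generalize qp q (q ^ 10) = a1 at *
  generalize qp (q ^ 2) (q ^ 10) = a2 at *
  generalize qp (q ^ 3) (q ^ 10) = a3 at *
  generalize qp (q ^ 4) (q ^ 10) = a4 at *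
  generalize qp (q ^ 5) (q ^ 10) = a5 at *
  generalize qp (q ^ 6) (q ^ 10) = a6 at *
  generalize qp (q ^ 7) (q ^ 10) = a7 at *
  generalize qp (q ^ 8) (q ^ 10) = a8 at *
  generalize qp (q ^ 9) (q ^ 10) = a9 at *
  generalize qp (q ^ 10) (q ^ 10) = a10 at *
  generalize qp (-q ^ 2) (q ^ 10) = b2 at *
  generalize qp (-q ^ 4) (q ^ 10) = b4 at *
  generalize qp (-q ^ 6) (q ^ 10) = b6 at *
  generalize qp (-q ^ 8) (q ^ 10) = b8 at *
  generalize qp (-q ^ 10) (q ^ 10) = b10 at *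
  clear hR hR4 hE1 hE2 hE4 hE5 hE20 five twenty ne ne' hn hp
  field_simp
  linear_combination (a5 ^ 2 * b10 ^ 2 * (a3 * a7 * (b4 * b6) - q * (a1 * a9 * (b2 * b8))) +
    a1 * a9 * (b2 * b8) * (a3 * a7 * (b4 * b6))) * h
end
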